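/- arXiv:1410.7078 — 4 statements merged into one kernel-verified Lean document; each statement's English description precedes it below -/
import Mathlib

section
/- Let (U, ω) be a finite-dimensional b-alternative algebra over F with unity element 1, and let J be a nil b-ideal of U. Suppose the quotient U/J contains b-ideals I_1, …, I_s, contained in bar(U)/J, whose sum is direct, where each I_p is a total matrix algebra of degree t_p spanned by matrix units which are the classes of elements u^{(p)}_{ij} ∈ bar(U) (1 ≤ i,j ≤ t_p). Then there exist elements f^{(p)}_{ij} ∈ bar(U) such that: for each p, f^{(p)}_{ij}·f^{(p)}_{kl} = δ_{jk}·f^{(p)}_{il} and f^{(p)}_{ij} − u^{(p)}_{ij} ∈ J for all indices; and f^{(p)}_{ij}·f^{(q)}_{kl} = 0 whenever p ≠ q. Hence bar(U) contains a direct sum of pairwise orthogonal total matrix algebras M_1 ⊕ ⋯ ⊕ M_s with M_p isomorphic to M_{t_p}(F) and with image I_1 ⊕ ⋯ ⊕ I_s modulo J. -/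
/-! Lifting of a direct sum of total matrix algebra b-ideals modulo a nil
b-ideal in a finite-dimensional b-alternative algebra with unity. -/

/-- Left powers: `lpow x n = x^(n+1)`.  In an alternative (hence
power-associative) ring powers of a single element are unambiguous. -/
def lpow {U : Type*} [Mul U] (x : U) : ℕ → U
  | 0 => x
  | n + 1 => x * lpow x n

/-- An element is nil(potent) if some power of it vanishes. -/
def IsNilElem {U : Type*} [Mul U] [Zero U] (x : U) : Prop := ∃ n : ℕ, lpow x n = 0

section Polynomial

open Polynomial

theorem exists_lifting_polynomial (F : Type*) [Field F] (n : ℕ) :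
    ∃ h r q : F[X], X * h - X = (X * X - X) * r ∧
      (X * h) * (X * h) - X * h = q * (X * X - X) ^ (n + 1) := by
  obtain ⟨a, ha⟩ : (X : F[X]) ^ (n + 1) ∣ 1 - (1 - X ^ (n + 1)) ^ (n + 1) := by
    have := sub_dvd_pow_sub_pow (1 : F[X]) (1 - X ^ (n + 1)) (n + 1)
    simpa using this
  obtain ⟨b, hb⟩ : (1 - X : F[X]) ∣ 1 - X ^ (n + 1) := by
    simpa using sub_dvd_pow_sub_pow (1 : F[X]) X (n + 1)
  have hX : X * (X ^ n * a) = 1 - (1 - X ^ (n + 1)) ^ (n + 1) := by rw [ha]; ring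
  obtain ⟨c, hc⟩ : (X - 1 : F[X]) ∣ X ^ n * a - 1 := by
    rw [← C_1, dvd_iff_isRoot, IsRoot.def]
    have := congrArg (eval (1 : F)) hX
    simpa [sub_eq_zero] using this
  refine ⟨X ^ n * a, c, (-1) ^ n * a * b ^ (n + 1), by linear_combination X * hc, ?_⟩
  have hX' : X * (X ^ n * a) - 1 = - ((1 - X) * b) ^ (n + 1) := by rw [hX, ← hb]; ring
  calc _ = (X ^ (n + 1) * a) * (X * (X ^ n * a) - 1) := by ring
    _ = _ := by
      rw [hX', show (X * X - X : F[X]) = (-1) * (X * (1 - X)) by ring, mul_pow, mul_pow, mul_pow]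
      have : ((-1 : F[X]) ^ n * (-1) ^ n) = 1 := by rw [← mul_pow]; simp
      linear_combination (X ^ (n + 1) * a * (1 - X) ^ (n + 1) * b ^ (n + 1)) * this

end Polynomial

/-- The left and right alternative laws. -/
structure IsAlternativeRing (U : Type*) [NonAssocRing U] : Prop where
  left : ∀ x y : U, (x * x) * y = x * (x * y)
  right : ∀ x y : U, (y * x) * x = y * (x * x)

namespace IsAlternativeRing

variable {U : Type*} [NonAssocRing U] (hU : IsAlternativeRing U)
include hU

theorem associator_swap_left (x y z : U) : associator x y z = -associator y x z := by
  have h := hU.left (x + y) z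
  have hx := hU.left x z
  have hy := hU.left y z
  simp only [add_mul, mul_add, associator] at *
  grind

theorem associator_swap_right (x y z : U) : associator x y z = -associator x z y := by
  have h := hU.right (y + z) x
  have hx := hU.right y x
  have hy := hU.right z x
  simp only [add_mul, mul_add, associator] at *
  grind

theorem flexible (x y : U) : (x * y) * x = x * (y * x) := by
  have h := hU.associator_swap_left x y x
  have h' := hU.right x y
  simp only [associator] at h
  grind

theorem left_moufang (x a y : U) : ((x * a) * x) * y = x * (a * (x * y)) := by
  have h1 := hU.associator_swap_left (x * a) x y
  have h2 := hU.associator_swap_right x a (x * y)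
  have h3 := hU.associator_swap_right (x * x) a y
  have h4 := hU.associator_swap_right x a y
  have h5 := hU.left x a
  have h6 := hU.left x y
  have h7 := hU.left x (a * y)
  have h8 := hU.left x (y * a)
  have h9 := congrArg (x * ·) h4
  simp only [associator, mul_sub, mul_neg] at *
  grind

section Polynomial

open Polynomial

variable {F : Type*} [Field F] [Module F U] [SMulCommClass F U U] [IsScalarTower F U U]

omit [IsScalarTower F U U] in
theorem mulLeft_pow_one (x : U) (n : ℕ) :
    LinearMap.mulLeft F ((LinearMap.mulLeft F x ^ n) 1) = LinearMap.mulLeft F x ^ n := by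
  induction n using Nat.twoStepInduction with
  | zero => ext y; simp
  | one => ext y; simp
  | more n h₀ h₁ =>
    ext y
    set a := (LinearMap.mulLeft F x ^ n) 1 with ha
    have hax : a * x = (LinearMap.mulLeft F x ^ (n + 1)) 1 := by
      rw [← LinearMap.mulLeft_apply (R := F) a x, h₀, pow_succ]
      simp
    have hxax : (LinearMap.mulLeft F x ^ (n + 2)) 1 = (x * a) * x := by
      rw [hU.flexible, hax, pow_succ' _ (n + 1)]
      simp
    rw [hxax, LinearMap.mulLeft_apply, hU.left_moufang, ← LinearMap.mulLeft_apply (R := F) a, h₀,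
      pow_succ', pow_succ]
    simp

theorem mulLeft_aeval_one (x : U) (p : F[X]) :
    LinearMap.mulLeft F (aeval (LinearMap.mulLeft F x) p 1) = aeval (LinearMap.mulLeft F x) p := by
  induction p using Polynomial.induction_on' with
  | add p q hp hq =>
    ext y
    have hp' := LinearMap.congr_fun hp y
    have hq' := LinearMap.congr_fun hq y
    simp only [LinearMap.mulLeft_apply] at hp' hq'
    simp [add_mul, hp', hq']
  | monomial n a =>
    ext y
    have h := LinearMap.congr_fun (hU.mulLeft_pow_one (F := F) x n) y
    simp only [LinearMap.mulLeft_apply] at h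
    simp [aeval_monomial, Algebra.algebraMap_eq_smul_one, smul_mul_assoc, h]

omit hU [IsScalarTower F U U] in
theorem lpow_eq_mulLeft_pow (x : U) (n : ℕ) :
    lpow x n = (LinearMap.mulLeft F x ^ (n + 1)) 1 := by
  induction n with
  | zero => simp [lpow]
  | succ n ih => rw [lpow, ih, pow_succ' _ (n + 1)]; simp

omit [IsScalarTower F U U] in
theorem exists_mulLeft_pow_eq_zero {x : U} (hx : IsNilElem x) :
    ∃ n : ℕ, LinearMap.mulLeft F x ^ (n + 1) = 0 := by
  obtain ⟨n, hn⟩ := hx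
  refine ⟨n, ?_⟩
  rw [← hU.mulLeft_pow_one, ← lpow_eq_mulLeft_pow, hn]
  simp

theorem exists_idempotent_lift (J : Submodule F U)
    (hJ : ∀ x ∈ J, ∀ y : U, x * y ∈ J) (hnil : ∀ x ∈ J, IsNilElem x)
    {e x : U} (hx : x * x - x ∈ J) (hex : e * x = 0) (hxe : x * e = 0) :
    ∃ g : U, g * g = g ∧ g - x ∈ J ∧ e * g = 0 ∧ g * e = 0 := by
  obtain ⟨n, hn⟩ := hU.exists_mulLeft_pow_eq_zero (F := F) (hnil _ hx)
  obtain ⟨h, r, q, hr, hq⟩ := exists_lifting_polynomial F n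
  set L := LinearMap.mulLeft F x with hL
  have hLn : LinearMap.mulLeft F (x * x - x) = aeval L (X * X - X : F[X]) := by
    ext y; simp [L, sub_mul, hU.left]
  have hmul (y : U) : aeval L (X * h) 1 * y = aeval L (X * h) y := by
    rw [← LinearMap.mulLeft_apply (R := F), hU.mulLeft_aeval_one]
  refine ⟨aeval L (X * h) 1, ?_, ?_, ?_, ?_⟩
  · rw [hmul, ← sub_eq_zero, ← Module.End.mul_apply, ← map_mul, ← LinearMap.sub_apply, ← map_sub,
      hq, map_mul, map_pow, ← hLn, hn]
    simp
  · have : aeval L (X * h) 1 - x = (x * x - x) * aeval L r 1 := by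
      rw [← LinearMap.mulLeft_apply (R := F) (x * x - x), hLn, ← Module.End.mul_apply, ← map_mul,
        ← hr]
      simp [L]
    rw [this]
    exact hJ _ hx _
  · have key (p : F[X]) : e * aeval L p x = 0 := by
      induction p using Polynomial.induction_on' with
      | add p q hp hq => simp [mul_add, hp, hq]
      | monomial n a =>
        have : e * (L ^ n) x = 0 := by
          induction n with
          | zero => simpa
          | succ n ih =>
            have h1 := hU.associator_swap_left e x ((L ^ n) x)
            simp only [associator, hex, hxe, ih] at h1
            rw [pow_succ', Module.End.mul_apply, hL, LinearMap.mulLeft_apply, ← hL]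
            simpa using h1
        simp [aeval_monomial, Algebra.algebraMap_eq_smul_one, mul_smul_comm, this]
    rw [mul_comm X h, map_mul]
    simpa [L] using key h
  · rw [hmul, mul_comm X h, map_mul]
    simp [L, hxe]

end Polynomial

theorem mul_eq_zero_of_mul_idempotent (h2 : ∀ y : U, y + y = 0 → y = 0) {e x g : U}
    (he : e * e = e) (hex : e * x = x) (hxe : x * e = x) (heg : e * g = 0) (hge : g * e = 0) :
    x * g = 0 ∧ g * x = 0 := by
  constructor
  · have h1 := hU.associator_swap_right x g e
    have h := hU.right e (x * g)
    apply h2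
    simp only [associator, hge, heg, hxe, mul_zero, sub_zero, he] at h1 h
    rw [h1] at h
    simp only [neg_mul, h1] at h
    grind
  · have h1 := hU.associator_swap_left e g x
    have h := hU.left e (g * x)
    apply h2
    simp only [associator, hge, heg, hex, zero_mul, zero_sub, neg_neg, he] at h1 h
    rw [neg_eq_iff_eq_neg] at h1
    simp only [h1, mul_neg] at h
    grind

/-- Any finite family of orthogonal idempotents modulo a nil ideal lifts to a family of orthogonal
idempotents. -/
theorem exists_orthogonal_idempotents_lift {F : Type*} [Field F] [Module F U] [SMulCommClass F U U]
    [IsScalarTower F U U] (h2 : ∀ y : U, y + y = 0 → y = 0) (J : Submodule F U)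
    (hJl : ∀ x ∈ J, ∀ y : U, y * x ∈ J) (hJr : ∀ x ∈ J, ∀ y : U, x * y ∈ J)
    (hnil : ∀ x ∈ J, IsNilElem x) {ι : Type*} [DecidableEq ι] (u : ι → U) (S : Finset ι)
    (hu : ∀ a b, u a * u b - (if a = b then u a else 0) ∈ J) :
    ∃ e : ι → U, (∀ a ∈ S, e a - u a ∈ J) ∧
      ∀ a ∈ S, ∀ b ∈ S, e a * e b = if a = b then e a else 0 := by
  induction S using Finset.induction_on with
  | empty => exact ⟨u, by simp⟩
  | insert a S ha ih =>
    obtain ⟨e, he, hee⟩ := ih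
    set E := ∑ b ∈ S, e b with hE
    have hEl (b) (hb : b ∈ S) : E * e b = e b := by
      rw [hE, Finset.sum_mul, Finset.sum_congr rfl fun c hc => hee c hc b hb]
      simp [hb]
    have hEr (b) (hb : b ∈ S) : e b * E = e b := by
      rw [hE, Finset.mul_sum, Finset.sum_congr rfl fun c hc => hee b hb c hc]
      simp [hb]
    have hEE : E * E = E := by
      conv_lhs => rw [hE, Finset.sum_mul, Finset.sum_congr rfl hEr]
    have hEu : E * u a ∈ J := by
      rw [hE, Finset.sum_mul]
      refine J.sum_mem fun b hb => ?_
      have h := J.add_mem (hJr _ (he b hb) (u a)) (hu b a)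
      rw [if_neg (by rintro rfl; exact ha hb)] at h
      simpa [sub_mul] using h
    have huE : u a * E ∈ J := by
      rw [hE, Finset.mul_sum]
      refine J.sum_mem fun b hb => ?_
      have h := J.add_mem (hJl _ (he b hb) (u a)) (hu a b)
      rw [if_neg (by rintro rfl; exact ha hb)] at h
      simpa [mul_sub] using h
    obtain ⟨x, hx⟩ : ∃ x, x = u a - E * u a - (u a - E * u a) * E := ⟨_, rfl⟩
    have hxu : x - u a ∈ J := by
      have : x - u a = -(E * u a) - u a * E + (E * u a) * E := by rw [hx, sub_mul]; abel
      rw [this]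
      exact J.add_mem (J.sub_mem (J.neg_mem hEu) huE) (hJr _ hEu _)
    have hxx : x * x - x ∈ J := by
      have h := hu a a
      rw [if_pos rfl] at h
      have : x * x - x = (x - u a) * x + u a * (x - u a) + (u a * u a - u a) - (x - u a) := by
        rw [sub_mul, mul_sub]; abel
      rw [this]
      exact J.sub_mem (J.add_mem (J.add_mem (hJr _ hxu _) (hJl _ hxu _)) h) hxu
    have hEy : E * (u a - E * u a) = 0 := by rw [mul_sub, ← hU.left, hEE, sub_self]
    have hEx : E * x = 0 := by rw [hx, mul_sub, ← hU.flexible, hEy]; simp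
    have hxE : x * E = 0 := by rw [hx, sub_mul, hU.right, hEE, sub_self]
    obtain ⟨g, hgg, hgx, hEg, hgE⟩ := hU.exists_idempotent_lift J hJr hnil hxx hEx hxE
    have horth (b) (hb : b ∈ S) :=
      hU.mul_eq_zero_of_mul_idempotent h2 hEE (hEl b hb) (hEr b hb) hEg hgE
    have hne (b) (hb : b ∈ S) : b ≠ a := by rintro rfl; exact ha hb
    refine ⟨Function.update e a g, ?_, ?_⟩
    · simp only [Finset.forall_mem_insert, Function.update_self]
      refine ⟨by simpa using J.add_mem hgx hxu, fun b hb => ?_⟩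
      rw [Function.update_of_ne (hne b hb)]
      exact he b hb
    · simp only [Finset.forall_mem_insert, Function.update_self]
      refine ⟨⟨by simpa, fun b hb => ?_⟩, fun b hb => ⟨?_, fun c hc => ?_⟩⟩
      · rw [Function.update_of_ne (hne b hb), if_neg (hne b hb).symm, (horth b hb).2]
      · rw [Function.update_of_ne (hne b hb), if_neg (hne b hb), (horth b hb).1]
      · rw [Function.update_of_ne (hne b hb), Function.update_of_ne (hne c hc), hee b hb c hc]

end IsAlternativeRing

/-- `x` lies in the Peirce space with indices `a`, `b` of the family of idempotents `e`. -/
structure IsPeirce {U ι : Type*} [NonAssocRing U] [DecidableEq ι] (e : ι → U) (a b : ι) (x : U) :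
    Prop where
  left : ∀ c, e c * x = if c = a then x else 0
  right : ∀ c, x * e c = if c = b then x else 0

namespace IsPeirce

variable {U ι : Type*} [NonAssocRing U] [DecidableEq ι] {e : ι → U} {a b c d : ι} {x y z : U}

theorem mul (hU : IsAlternativeRing U) (hx : IsPeirce e a b x) (hy : IsPeirce e b c y) :
    IsPeirce e a c (x * y) := by
  have h (i : ι) : associator x (e i) y = 0 := by
    simp [associator, hx.right, hy.left, ite_mul, mul_ite]
  constructor <;> intro i
  · have h1 := hU.associator_swap_left (e i) x y
    rw [h, neg_zero, associator, sub_eq_zero, hx.left] at h1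
    rw [← h1, ite_mul, zero_mul]
  · have h1 := hU.associator_swap_right x y (e i)
    rw [h, neg_zero, associator, sub_eq_zero, hy.right] at h1
    rw [h1, mul_ite, mul_zero]

theorem mul_eq_zero (hU : IsAlternativeRing U) (h2 : ∀ y : U, y + y = 0 → y = 0)
    (he : ∀ i, e i * e i = e i)
    (hx : IsPeirce e a b x) (hy : IsPeirce e c d y) (hbc : b ≠ c) (h : a = b ∨ a ≠ c ∨ b ≠ d) :
    x * y = 0 := by
  have key1 (i : ι) := hU.associator_swap_left (e i) x y
  have key2 (i : ι) := hU.associator_swap_right x y (e i)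
  have l1 (i : ι) := hU.left (e i) (x * y)
  have l2 (i : ι) := hU.right (e i) (x * y)
  simp only [associator, hx.right, hx.left, hy.left, hy.right, he] at key1 key2 l1 l2
  apply h2
  rcases h with rfl | h | h
  · have h1 : e a * (x * y) = x * y + x * y := by
      have := key1 a
      simp only [if_true, hbc, if_false, mul_zero] at this
      grind
    have := l1 a
    simp only [h1, mul_add] at this
    grind
  · have h1 : e c * (x * y) = -(x * y) := by
      have := key1 c
      simp only [if_true, hbc.symm, h.symm, if_false, zero_mul] at this
      grind
    have := l1 c
    simp only [h1, mul_neg] at this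
    grind
  · have h1 : x * y * e b = -(x * y) := by
      have := key2 b
      simp only [if_true, hbc, h, if_false, mul_zero] at this
      grind
    have := l2 b
    simp only [h1, neg_mul] at this
    grind

theorem mul_self (hU : IsAlternativeRing U) (hx : IsPeirce e a b x) (hab : a ≠ b) : x * x = 0 := by
  have h1 := hU.left x (e b)
  have h2 := hU.associator_swap_right x x (e b)
  simp only [associator, hx.right, hx.left, if_true, hab.symm, if_false, mul_zero] at h1 h2
  grind

end IsPeirce

namespace IsAlternativeRing

variable {U ι : Type*} [NonAssocRing U] [DecidableEq ι] (hU : IsAlternativeRing U)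
  (h2 : ∀ y : U, y + y = 0 → y = 0) {e : ι → U}
  (he : ∀ a b, e a * e b = if a = b then e a else 0)
include hU

omit [DecidableEq ι] in
theorem mul_assoc_of_mul_eq_zero_left {x y z : U} (h1 : y * x = 0) (h2 : x * z = 0) :
    (x * y) * z = x * (y * z) := by
  have := hU.associator_swap_left x y z
  simp only [associator, h1, h2, zero_mul, mul_zero] at this
  grind

omit [DecidableEq ι] in
theorem mul_assoc_of_mul_eq_zero_right {x y z : U} (h1 : x * z = 0) (h2 : z * y = 0) :
    (x * y) * z = x * (y * z) := by
  have := hU.associator_swap_right x y z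
  simp only [associator, h1, h2, zero_mul, mul_zero] at this
  grind

include h2 he

theorem orthogonal_mul_mul (a b : ι) (x : U) :
    e a * (e b * x) = if a = b then e a * x else 0 := by
  split_ifs with h
  · subst h
    rw [← hU.left, he, if_pos rfl]
  · have h1 := hU.associator_swap_left (e a) (e b) x
    simp only [associator, he, h, Ne.symm h, if_false, zero_mul] at h1
    have h3 := hU.left (e a) (e b * x)
    have h4 := hU.left (e a) x
    simp only [he, if_true] at h3 h4
    have h5 : e a * (e b * x) = - (e b * (e a * x)) := by grind
    have h6 := congrArg (e a * ·) h5
    have h7 := hU.associator_swap_left (e a) (e b) (e a * x)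
    simp only [associator, he, h, Ne.symm h, if_false, zero_mul, ← h4] at h7
    simp only [mul_neg] at h6
    apply h2
    grind

theorem orthogonal_mul_mul_right (a b : ι) (x : U) :
    (x * e b) * e a = if a = b then x * e a else 0 := by
  split_ifs with h
  · subst h
    rw [hU.right, he, if_pos rfl]
  · have h1 := hU.associator_swap_right x (e a) (e b)
    simp only [associator, he, h, Ne.symm h, if_false, mul_zero] at h1
    have h3 := hU.right (e a) (x * e b)
    have h4 := hU.right (e a) x
    simp only [he, if_true] at h3 h4
    have h5 : (x * e b) * e a = - ((x * e a) * e b) := by grind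
    have h6 := congrArg (· * e a) h5
    have h7 := hU.associator_swap_right (x * e a) (e a) (e b)
    simp only [associator, he, h, Ne.symm h, if_false, mul_zero, h4] at h7
    simp only [neg_mul] at h6
    apply h2
    grind

theorem orthogonal_mul_assoc (a b : ι) (x : U) : (e a * x) * e b = e a * (x * e b) := by
  by_cases h : a = b
  · subst h; exact hU.flexible _ _
  · have h1 := hU.associator_swap_right (e a) x (e b)
    have h3 := hU.orthogonal_mul_mul h2 he a b x
    simp only [associator, he, h, if_false, zero_mul, h3] at h1
    grind

theorem isPeirce_mul_mul (a b : ι) (x : U) : IsPeirce e a b ((e a * x) * e b) := by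
  constructor <;> intro c
  · rw [← hU.orthogonal_mul_assoc h2 he, hU.orthogonal_mul_mul h2 he]
    split_ifs with h <;> simp [h]
  · rw [hU.orthogonal_mul_mul_right h2 he]
    split_ifs with h <;> simp [h]

theorem isPeirce_of_mul_eq {a b : ι} {x : U} (hl : e a * x = x) (hr : x * e b = x) :
    IsPeirce e a b x := by
  have := hU.isPeirce_mul_mul h2 he a b x
  rwa [hl, hr] at this

theorem isPeirce_idempotent (a : ι) : IsPeirce e a a (e a) :=
  hU.isPeirce_of_mul_eq h2 he (by simp [he]) (by simp [he])

theorem matrixUnits_of_row_column {o : ι} {r c : ι → U} (hr : ∀ i, IsPeirce e i o (r i))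
    (hc : ∀ i, IsPeirce e o i (c i)) (hro : r o = e o) (hco : c o = e o)
    (hcr : ∀ i, c i * r i = e o) (hrc : ∀ i, r i * c i = e i) (i j k l : ι) :
    (r i * c j) * (r k * c l) = if j = k then r i * c l else 0 := by
  have hee (i) : e i * e i = e i := by simp [he]
  have hf (i j) : IsPeirce e i j (r i * c j) := (hr i).mul hU (hc j)
  split_ifs with hjk
  · subst hjk
    have h1 : (c j * r j) * c l = c j * (r j * c l) := by
      by_cases hj : j = o
      · rw [hj, hro, hco, hee, (hc l).left, if_pos rfl, (hc l).left, if_pos rfl]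
      by_cases hlj : l = j
      · rw [hlj, hU.flexible]
      by_cases hl : l = o
      · rw [hl, hco, hcr, hee, (hr j).right, if_pos rfl, hcr]
      exact hU.mul_assoc_of_mul_eq_zero_right
        ((hc j).mul_eq_zero hU h2 hee (hc l) hj (.inr (.inr (Ne.symm hlj))))
        ((hc l).mul_eq_zero hU h2 hee (hr j) hlj (.inr (.inr hl)))
    have h3 : (r i * c j) * (r j * c l) = r i * (c j * (r j * c l)) := by
      by_cases hi : i = o
      · have := ((hc j).mul hU (hf j l)).left o
        rw [if_pos rfl] at this
        rw [hi, hro, this, (hc j).left, if_pos rfl]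
      by_cases hj : j = o
      · have := (hf o l).left o
        rw [if_pos rfl] at this
        rw [hj, hco, this, (hr i).right, if_pos rfl]
      by_cases hlj : l = j
      · have := (hf i j).right j
        rw [if_pos rfl] at this
        rw [hlj, hrc, this, (hc j).right, if_pos rfl]
      by_cases hij : i = j
      · by_cases hl : l = o
        · subst hij
          have : r i * c l = r i := by rw [hl, hco, (hr i).right, if_pos rfl]
          rw [this, hU.flexible]
        · exact hU.mul_assoc_of_mul_eq_zero_right
            ((hr i).mul_eq_zero hU h2 hee (hf j l) (Ne.symm hj) (.inr (.inr (Ne.symm hl))))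
            ((hf j l).mul_eq_zero hU h2 hee (hc j) hl (.inr (.inl hj)))
      · exact hU.mul_assoc_of_mul_eq_zero_left
          ((hc j).mul_eq_zero hU h2 hee (hr i) (Ne.symm hij) (.inr (.inr hj)))
          ((hr i).mul_eq_zero hU h2 hee (hf j l) (Ne.symm hj) (.inr (.inl hij)))
    rw [h3, ← h1, hcr, (hc l).left, if_pos rfl]
  · by_cases h : i = k ∧ j = l
    · obtain ⟨rfl, rfl⟩ := h
      exact (hf i j).mul_self hU (Ne.symm hjk)
    · refine (hf i j).mul_eq_zero hU h2 hee (hf k l) hjk ?_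
      tauto

end IsAlternativeRing

section Ideal

variable {F U κ : Type*} [Field F] [NonAssocRing U] [Module F U] [DecidableEq κ]
  {J : Submodule F U}
  (hJl : ∀ x ∈ J, ∀ y : U, y * x ∈ J) (hJr : ∀ x ∈ J, ∀ y : U, x * y ∈ J)

include hJl hJr in
theorem mul_sub_mul_mem {a a' b b' : U} (ha : a - a' ∈ J) (hb : b - b' ∈ J) :
    a * b - a' * b' ∈ J := by
  have : a * b - a' * b' = (a - a') * b + a' * (b - b') := by rw [sub_mul, mul_sub]; abel
  rw [this]
  exact J.add_mem (hJr _ ha _) (hJl _ hb _)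

theorem lpow_of_mul_self {x : U} (hx : x * x = x) (n : ℕ) : lpow x n = x := by
  induction n with
  | zero => rfl
  | succ n ih => rw [lpow, ih, hx]

/-- An element of a Peirce algebra congruent to the identity modulo a nil ideal has a right
inverse congruent to the identity. -/
theorem IsPeirce.exists_mul_eq_idempotent (hU : IsAlternativeRing U)
    (hJr : ∀ x ∈ J, ∀ y : U, x * y ∈ J)
    (hnil : ∀ x ∈ J, IsNilElem x) {e : κ → U} {o : κ} {w : U} (he : IsPeirce e o o (e o))
    (hw : IsPeirce e o o w) (hwe : w - e o ∈ J) :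
    ∃ v, IsPeirce e o o v ∧ v - e o ∈ J ∧ w * v = e o := by
  have hn : e o - w ∈ J := by simpa using J.neg_mem hwe
  obtain ⟨m, hm⟩ := hnil _ hn
  set n := e o - w with hndef
  have hnP : IsPeirce e o o n := by
    constructor <;> intro c
    · rw [hndef, mul_sub, he.left, hw.left]; split_ifs <;> simp
    · rw [hndef, sub_mul, he.right, hw.right]; split_ifs <;> simp
  have key (k : ℕ) : ∃ v, IsPeirce e o o v ∧ v - e o ∈ J ∧ v - n * v = e o - lpow n k := by
    induction k with
    | zero => exact ⟨e o, he, by simp, by rw [hnP.right, if_pos rfl, lpow]⟩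
    | succ k ih =>
      obtain ⟨v, hv, hvJ, hvn⟩ := ih
      have hP := hnP.mul hU hv
      refine ⟨e o + n * v, ⟨fun c => ?_, fun c => ?_⟩, by simpa using hJr _ hn v, ?_⟩
      · rw [mul_add, he.left, hP.left]; split_ifs <;> simp
      · rw [add_mul, he.right, hP.right]; split_ifs <;> simp
      · have h : v = n * v + e o - lpow n k := by rw [add_sub_assoc, ← hvn]; abel
        have h' := congrArg (n * ·) h
        simp only [mul_add, mul_sub] at h'
        rw [lpow, mul_add]
        grind
  obtain ⟨v, hv, hvJ, hvn⟩ := key m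
  refine ⟨v, hv, hvJ, ?_⟩
  have hwn : w = e o - n := by rw [hndef]; abel
  rw [hwn, sub_mul, hv.left, if_pos rfl, hvn, hm, sub_zero]

namespace IsAlternativeRing

variable (hU : IsAlternativeRing U) (h2 : ∀ y : U, y + y = 0 → y = 0)
  (hnil : ∀ x ∈ J, IsNilElem x) {e : κ → U}
  (he : ∀ a b, e a * e b = if a = b then e a else 0)
include hU h2 hnil he hJl hJr

theorem exists_row_column_lift {i o : κ} (hio : i ≠ o) {a b : U} (ha : e i * a - a ∈ J)
    (ha' : a * e o - a ∈ J) (hb : e o * b - b ∈ J) (hb' : b * e i - b ∈ J)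
    (hab : a * b - e i ∈ J) (hba : b * a - e o ∈ J) :
    ∃ r c, IsPeirce e i o r ∧ IsPeirce e o i c ∧ r - a ∈ J ∧ c - b ∈ J ∧
      c * r = e o ∧ r * c = e i := by
  have hee (i) : e i * e i = e i := by simp [he]
  set v := (e i * a) * e o with hv
  set c := (e o * b) * e i with hc
  have hvP : IsPeirce e i o v := hU.isPeirce_mul_mul h2 he i o a
  have hcP : IsPeirce e o i c := hU.isPeirce_mul_mul h2 he o i b
  have hva : v - a ∈ J := by
    have := J.add_mem (hJr _ ha (e o)) ha'
    rwa [sub_mul, sub_add_sub_cancel] at this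
  have hcb : c - b ∈ J := by
    have := J.add_mem (hJr _ hb (e i)) hb'
    rwa [sub_mul, sub_add_sub_cancel] at this
  have hcv : c * v - e o ∈ J := by
    simpa using J.add_mem (mul_sub_mul_mem hJl hJr hcb hva) hba
  have ho := hU.isPeirce_idempotent h2 he o
  obtain ⟨w, hwP, hwJ, hw⟩ := IsPeirce.exists_mul_eq_idempotent hU hJr hnil ho
    (hcP.mul hU hvP) hcv
  have hrP := hvP.mul hU hwP
  have hra : v * w - a ∈ J := by
    have := mul_sub_mul_mem hJl hJr hva hwJ
    simpa using J.add_mem this ha'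
  have hcr : c * (v * w) = e o := by
    rw [← hw]
    exact (hU.mul_assoc_of_mul_eq_zero_right
      (hcP.mul_eq_zero hU h2 hee hwP hio (.inr (.inr hio)))
      (hwP.mul_eq_zero hU h2 hee hvP (Ne.symm hio) (.inl rfl))).symm
  set r := v * w with hr
  refine ⟨r, c, hrP, hcP, hra, hcb, hcr, ?_⟩
  set g := r * c with hg
  have hgP : IsPeirce e i i g := hrP.mul hU hcP
  have hgr : g * r = r := by rw [hg, hU.flexible, hcr, hrP.right, if_pos rfl]
  have hgg : g * g = g := by
    have : (g * r) * c = g * (r * c) := hU.mul_assoc_of_mul_eq_zero_left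
      (hrP.mul_eq_zero hU h2 hee hgP (Ne.symm hio) (.inr (.inr (Ne.symm hio))))
      (hgP.mul_eq_zero hU h2 hee hcP hio (.inl rfl))
    rw [← hg, hgr] at this
    exact this.symm
  have hgJ : g - e i ∈ J := by
    simpa using J.add_mem (mul_sub_mul_mem hJl hJr hra hcb) hab
  have hd : (g - e i) * (g - e i) = -(g - e i) := by
    rw [sub_mul, mul_sub, mul_sub, hgg, hee, hgP.left, hgP.right, if_pos rfl]
    abel
  obtain ⟨m, hm⟩ := hnil _ (J.neg_mem hgJ)
  rw [lpow_of_mul_self (by rw [neg_mul_neg, hd])] at hm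
  exact sub_eq_zero.mp (neg_eq_zero.mp hm)

/-- Matrix units modulo a nil ideal whose diagonal lifts to orthogonal idempotents lift to matrix
units with that diagonal. -/
theorem exists_matrixUnits_lift (u : κ → κ → U)
    (hu : ∀ i j k l, u i j * u k l - (if j = k then u i l else 0) ∈ J)
    (heu : ∀ i, e i - u i i ∈ J) :
    ∃ f : κ → κ → U, (∀ i j k l, f i j * f k l = if j = k then f i l else 0) ∧
      (∀ i j, f i j - u i j ∈ J) ∧ ∀ i j, IsPeirce e i j (f i j) := by
  rcases isEmpty_or_nonempty κ with _ | ⟨⟨o⟩⟩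
  · exact ⟨u, by simp⟩
  have hleft (i j) : e i * u i j - u i j ∈ J := by
    have h := J.add_mem (hJr _ (heu i) (u i j)) (hu i i i j)
    rwa [if_pos rfl, sub_mul, sub_add_sub_cancel] at h
  have hright (i j) : u i j * e j - u i j ∈ J := by
    have h := J.add_mem (hJl _ (heu j) (u i j)) (hu i j j j)
    rwa [if_pos rfl, mul_sub, sub_add_sub_cancel] at h
  have hmul (i j) : u i j * u j i - e i ∈ J := by
    have h := J.sub_mem (hu i j j i) (heu i)
    rwa [if_pos rfl, sub_sub_sub_cancel_right] at h
  have key (i : κ) : ∃ r c, IsPeirce e i o r ∧ IsPeirce e o i c ∧ r - u i o ∈ J ∧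
      c - u o i ∈ J ∧ c * r = e o ∧ r * c = e i ∧ (i = o → r = e o ∧ c = e o) := by
    by_cases hio : i = o
    · subst hio
      have h := hU.isPeirce_idempotent h2 he i
      exact ⟨e i, e i, h, h, heu i, heu i, by simp [he], by simp [he], by simp⟩
    · obtain ⟨r, c, h⟩ := exists_row_column_lift hJl hJr hU h2 hnil he hio
        (hleft i o) (hright i o) (hleft o i) (hright o i) (hmul i o) (hmul o i)
      exact ⟨r, c, by tauto⟩
  choose r c hr hc hrJ hcJ hcr hrc ho using key
  refine ⟨fun i j => r i * c j,
    hU.matrixUnits_of_row_column h2 he hr hc (ho o rfl).1 (ho o rfl).2 hcr hrc,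
    fun i j => ?_, fun i j => (hr i).mul hU (hc j)⟩
  have h := J.add_mem (mul_sub_mul_mem hJl hJr (hrJ i) (hcJ j)) (hu i o o j)
  rwa [if_pos rfl, sub_add_sub_cancel] at h

end IsAlternativeRing

end Ideal

/-- Let `(U, ω)` be a finite-dimensional b-alternative algebra over `F` with
unity element `1` and `J` a nil b-ideal of `U`.  Suppose `U/J` contains
b-ideals `I_1, …, I_s ⊆ bar(U)/J` whose sum is direct, where `I_p` is a total
matrix algebra of degree `t_p` spanned by matrix units given by the classes of
elements `u^{(p)}_{ij} ∈ bar(U)`.  Then there are elements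
`f^{(p)}_{ij} ∈ bar(U)` which are exact matrix units for each `p`, congruent to
the `u^{(p)}_{ij}` modulo `J`, and with `f^{(p)}_{ij} · f^{(q)}_{kl} = 0` for
`p ≠ q`; hence `bar(U)` contains a direct sum of pairwise orthogonal total
matrix algebras mapping onto `I_1 ⊕ ⋯ ⊕ I_s` modulo `J`. -/
theorem matrix_algebras_direct_sum_lifting
    (F : Type*) [Field F]
    (hchar : ringChar F ≠ 2 ∧ ringChar F ≠ 3 ∧ ringChar F ≠ 5)
    (U : Type*) [NonAssocRing U] [Module F U]
    [SMulCommClass F U U] [IsScalarTower F U U] [FiniteDimensional F U]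
    (halt : ∀ x y : U, (x * x) * y = x * (x * y) ∧ (y * x) * x = y * (x * x))
    (ω : U →ₗ[F] F) (hωmul : ∀ x y : U, ω (x * y) = ω x * ω y) (hω0 : ω ≠ 0)
    (J : Submodule F U)
    (hJbar : ∀ x ∈ J, ω x = 0)
    (hJideal : ∀ x ∈ J, ∀ y : U, y * x ∈ J ∧ x * y ∈ J)
    (hJnil : ∀ x ∈ J, IsNilElem x)
    (s : ℕ) (t : Fin s → ℕ)
    (u : (p : Fin s) → Fin (t p) → Fin (t p) → U)
    (hubar : ∀ p i j, ω (u p i j) = 0)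
    -- the classes of the `u p i j` are matrix units of degree `t p`
    (humul : ∀ p i j k l, u p i j * u p k l - (if j = k then u p i l else 0) ∈ J)
    -- the span of the classes of the `u p _ _` is a two-sided ideal of `U/J`
    (huideal : ∀ p i j, ∀ x : U,
      (∃ c : Fin (t p) → Fin (t p) → F,
        x * u p i j - ∑ k, ∑ l, c k l • u p k l ∈ J) ∧
      (∃ c : Fin (t p) → Fin (t p) → F,
        u p i j * x - ∑ k, ∑ l, c k l • u p k l ∈ J))
    -- the classes of all the `u p i j` are linearly independent (in particular
    -- the sum of the ideals `I_p` is direct)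
    (huindep : ∀ c : (p : Fin s) → Fin (t p) → Fin (t p) → F,
      (∑ p, ∑ i, ∑ j, c p i j • u p i j) ∈ J → ∀ p i j, c p i j = 0) :
    ∃ f : (p : Fin s) → Fin (t p) → Fin (t p) → U,
      (∀ p i j, ω (f p i j) = 0) ∧
      (∀ p i j k l, f p i j * f p k l = if j = k then f p i l else 0) ∧
      (∀ p i j, f p i j - u p i j ∈ J) ∧
      (∀ p q, p ≠ q → ∀ i j k l, f p i j * f q k l = 0) := by
  have hU : IsAlternativeRing U := ⟨fun x y => (halt x y).1, fun x y => (halt x y).2⟩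
  have h2 (y : U) (hy : y + y = 0) : y = 0 := by
    have : (2 : F) ≠ 0 := Ring.two_ne_zero hchar.1
    rw [← two_smul F] at hy
    exact (smul_eq_zero.mp hy).resolve_left this
  have hJl (x) (hx : x ∈ J) (y : U) := (hJideal x hx y).1
  have hJr (x) (hx : x ∈ J) (y : U) := (hJideal x hx y).2
  have hcross (p q) (hpq : p ≠ q) (i j k l) : u p i j * u q k l ∈ J := by
    obtain ⟨c, hc⟩ := (huideal p i j (u q k l)).2
    obtain ⟨d, hd⟩ := (huideal q k l (u p i j)).1
    have hcd := J.sub_mem hd hc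
    rw [sub_sub_sub_cancel_left] at hcd
    have hc0 : ∀ i j, c i j = 0 := by
      have := huindep (Function.update (Function.update 0 q (-d)) p c) ?_ p
      · simpa using this
      rw [← Finset.add_sum_erase _ _ (Finset.mem_univ p),
        ← Finset.add_sum_erase _ _ (Finset.mem_erase.2 ⟨hpq.symm, Finset.mem_univ q⟩),
        Finset.sum_eq_zero (s := (Finset.univ.erase p).erase q)]
      · simpa [Function.update_of_ne hpq.symm, sub_eq_add_neg] using hcd
      · intro x hx
        simp only [Finset.mem_erase] at hx
        simp [Function.update_of_ne hx.1, Function.update_of_ne hx.2.1]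
    simpa [hc0] using hc
  have hdiag (a b : Σ p, Fin (t p)) :
      u a.1 a.2 a.2 * u b.1 b.2 b.2 - (if a = b then u a.1 a.2 a.2 else 0) ∈ J := by
    obtain ⟨p, i⟩ := a
    obtain ⟨q, j⟩ := b
    by_cases hpq : p = q
    · subst hpq
      have := humul p i i j j
      by_cases hij : i = j
      · subst hij; simpa using this
      · simpa [hij] using this
    · simpa [hpq] using hcross p q hpq i i j j
  obtain ⟨e, heu, he⟩ := hU.exists_orthogonal_idempotents_lift h2 J hJl hJr hJnil
    (fun a : Σ p, Fin (t p) => u a.1 a.2 a.2) Finset.univ hdiag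
  simp only [Finset.mem_univ, true_imp_iff] at heu he
  have key (p : Fin s) := hU.exists_matrixUnits_lift hJl hJr h2 hJnil
    (e := fun i => e ⟨p, i⟩) (fun i j => by simp [he]) (u p) (humul p) (fun i => heu ⟨p, i⟩)
  choose f hf hfu hfe using key
  have hfP (p i j) : IsPeirce e ⟨p, i⟩ ⟨p, j⟩ (f p i j) :=
    hU.isPeirce_of_mul_eq h2 he (by simp [(hfe p i j).left i]) (by simp [(hfe p i j).right j])
  refine ⟨f, fun p i j => ?_, hf, hfu, fun p q hpq i j k l => ?_⟩
  · have := hJbar _ (hfu p i j)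
    rwa [map_sub, hubar, sub_zero] at this
  · exact (hfP p i j).mul_eq_zero hU h2 (by simp [he]) (hfP q k l) (by simp [hpq])
      (.inr (.inl (by simp [hpq])))
end

section
/- Let (U, ω) be a finite-dimensional b-alternative algebra over F with unity element 1, and let J be a nil b-ideal of U. Suppose the quotient U/J contains b-ideals J_1, …, J_r, contained in bar(U)/J, whose sum is direct and which satisfy J_p·J_p = 0 for each p. Then bar(U) contains a vector subspace V such that the quotient map U → U/J restricts to a linear isomorphism from V onto J_1 ⊕ ⋯ ⊕ J_r and such that V·V ⊆ J. In particular, lifting a basis of J_1 ⊕ ⋯ ⊕ J_r to representatives in bar(U) yields a linearly independent family all of whose pairwise products lie in J. -/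
/-- If the sum of the `W p` is direct modulo `J`, then distinct `W p`, `W q` meet inside `J`. -/
theorem mem_of_mem_of_mem_of_direct {F U ι : Type*} [Field F] [AddCommGroup U] [Module F U]
    [Fintype ι] {J : Submodule F U} {W : ι → Submodule F U}
    (hdirect : ∀ x : ι → U, (∀ p, x p ∈ W p) → (∑ p, x p) ∈ J → ∀ p, x p ∈ J)
    {p q : ι} (hpq : p ≠ q) {z : U} (hp : z ∈ W p) (hq : z ∈ W q) : z ∈ J := by
  classical
  have h := hdirect (Pi.single p z - Pi.single q z) (fun i => ?_) (by simp) p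
  · simpa [hpq] using h
  · refine sub_mem ?_ ?_
    · obtain rfl | hi := eq_or_ne i p <;> simp [*]
    · obtain rfl | hi := eq_or_ne i q <;> simp [*]

/-- If `W p * W q ⊆ J` for all `p`, `q`, then the square of the sum of the `W p` lies in `J`. -/
theorem mul_mem_of_mem_iSup {F U ι : Type*} [Field F] [NonUnitalNonAssocRing U] [Module F U]
    [SMulCommClass F U U] [IsScalarTower F U U] {J : Submodule F U} {W : ι → Submodule F U}
    (h : ∀ p q, ∀ x ∈ W p, ∀ y ∈ W q, x * y ∈ J)
    {x y : U} (hx : x ∈ ⨆ p, W p) (hy : y ∈ ⨆ p, W p) : x * y ∈ J := by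
  have hle : (⨆ p, W p) ≤ J.comap (LinearMap.mulRight F y) := iSup_le fun p a ha =>
    (iSup_le fun q b hb => h p q a ha b hb : (⨆ q, W q) ≤ J.comap (LinearMap.mulLeft F a)) hy
  exact hle hx

/-- A submodule `J` of a vector space has a complement inside every submodule containing it. -/
theorem exists_inf_eq_bot_sup_eq_of_le {F U : Type*} [Field F] [AddCommGroup U] [Module F U]
    {J S : Submodule F U} (hJS : J ≤ S) : ∃ V ≤ S, V ⊓ J = ⊥ ∧ V ⊔ J = S := by
  obtain ⟨C, hC⟩ := exists_isCompl J
  refine ⟨S ⊓ C, inf_le_left, ?_, ?_⟩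
  · rw [inf_assoc, hC.symm.inf_eq_bot, inf_bot_eq]
  · rw [inf_sup_assoc_of_le C hJS, hC.symm.sup_eq_top, inf_top_eq]

/-- Let `(U, ω)` be a finite-dimensional b-alternative algebra over `F` with
unity element `1` and `J` a nil b-ideal of `U`.  Suppose `U/J` contains
b-ideals `J_1, …, J_r ⊆ bar(U)/J` (here realized as submodules `W p` of `U`
containing `J`) whose sum is direct and which satisfy `J_p · J_p = 0`.  Then
`bar(U)` contains a subspace `V` such that the quotient map `U → U/J` restricts
to a linear isomorphism from `V` onto `J_1 ⊕ ⋯ ⊕ J_r` (i.e. `V ⊓ J = ⊥` and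
`V ⊔ J = W_1 ⊔ ⋯ ⊔ W_r ⊔ J`) and `V · V ⊆ J`. -/
theorem square_zero_ideals_lifting
    (F : Type*) [Field F]
    (hchar : ringChar F ≠ 2 ∧ ringChar F ≠ 3 ∧ ringChar F ≠ 5)
    (U : Type*) [NonAssocRing U] [Module F U]
    [SMulCommClass F U U] [IsScalarTower F U U] [FiniteDimensional F U]
    (halt : ∀ x y : U, (x * x) * y = x * (x * y) ∧ (y * x) * x = y * (x * x))
    (ω : U →ₗ[F] F) (hωmul : ∀ x y : U, ω (x * y) = ω x * ω y) (hω0 : ω ≠ 0)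
    (J : Submodule F U)
    (hJbar : ∀ x ∈ J, ω x = 0)
    (hJideal : ∀ x ∈ J, ∀ y : U, y * x ∈ J ∧ x * y ∈ J)
    (hJnil : ∀ x ∈ J, IsNilElem x)
    (r : ℕ) (W : Fin r → Submodule F U)
    (hJW : ∀ p, J ≤ W p)
    (hWbar : ∀ p, ∀ x ∈ W p, ω x = 0)
    (hWideal : ∀ p, ∀ x ∈ W p, ∀ y : U, y * x ∈ W p ∧ x * y ∈ W p)
    (hWsq : ∀ p, ∀ x ∈ W p, ∀ y ∈ W p, x * y ∈ J)
    (hWdirect : ∀ x : Fin r → U, (∀ p, x p ∈ W p) → (∑ p, x p) ∈ J →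
      ∀ p, x p ∈ J) :
    ∃ V : Submodule F U,
      (∀ v ∈ V, ω v = 0) ∧
      (∀ v ∈ V, ∀ w ∈ V, v * w ∈ J) ∧
      V ⊓ J = ⊥ ∧
      V ⊔ J = (⨆ p, W p) ⊔ J := by
  have hmul : ∀ p q, ∀ x ∈ W p, ∀ y ∈ W q, x * y ∈ J := by
    intro p q x hx y hy
    obtain rfl | hpq := eq_or_ne p q
    · exact hWsq p x hx y hy
    · exact mem_of_mem_of_mem_of_direct hWdirect hpq (hWideal p x hx y).2 (hWideal q y hy x).1
  have hsq : ∀ v ∈ (⨆ p, W p) ⊔ J, ∀ w ∈ (⨆ p, W p) ⊔ J, v * w ∈ J := by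
    intro v hv w hw
    obtain ⟨a, ha, i, hi, rfl⟩ := Submodule.mem_sup.1 hv
    obtain ⟨b, hb, j, hj, rfl⟩ := Submodule.mem_sup.1 hw
    rw [add_mul, mul_add]
    exact add_mem (add_mem (mul_mem_of_mem_iSup hmul ha hb) (hJideal j hj a).1)
      (hJideal i hi (b + j)).2
  have hbar : (⨆ p, W p) ⊔ J ≤ LinearMap.ker ω := sup_le (iSup_le hWbar) hJbar
  obtain ⟨V, hVS, hinf, hsup⟩ :=
    exists_inf_eq_bot_sup_eq_of_le (le_sup_right : J ≤ (⨆ p, W p) ⊔ J)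
  exact ⟨V, fun v hv => hbar (hVS hv), fun v hv w hw => hsq v (hVS hv) w (hVS hw), hinf, hsup⟩
end

section
/- Let U be a finite-dimensional alternative algebra over F and let I be a minimal two-sided ideal of U, i.e. I ≠ (0) and the only two-sided ideals of U contained in I are (0) and I. Then either I·I = 0 or I is a simple algebra (I·I ≠ 0 and I has no two-sided ideals of its own other than (0) and I). -/
namespace AlternativeAlgebra

section Alternative

variable {F U : Type*} [Field F] [NonUnitalNonAssocRing U] [Module F U]

/-- Linearized left alternative law. -/
theorem mul_mul_left_linearized (hl : ∀ x y : U, (x * x) * y = x * (x * y)) (x y z : U) :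
    x * (y * z) = (x * y) * z + (y * x) * z - y * (x * z) := by
  have h := hl (x + y) z
  simp only [add_mul, mul_add, hl x z, hl y z] at h
  grind

/-- Linearized right alternative law. -/
theorem mul_mul_right_linearized (hr : ∀ x y : U, (y * x) * x = y * (x * x)) (x y z : U) :
    (z * x) * y = z * (x * y) + z * (y * x) - (z * y) * x := by
  have h := hr (x + y) z
  simp only [add_mul, mul_add, hr x z, hr y z] at h
  grind

theorem mem_of_add_self_mem (h2 : (2 : F) ≠ 0) {A : Submodule F U} {x : U}
    (h : x + x ∈ A) : x ∈ A := by
  have h' := A.smul_mem (2 : F)⁻¹ h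
  rwa [← two_smul F x, inv_smul_smul₀ h2] at h'

/-- `K` is an ideal of the subalgebra `I`. -/
def IsIdealOf (K I : Submodule F U) : Prop :=
  ∀ x ∈ K, ∀ y ∈ I, y * x ∈ K ∧ x * y ∈ K

/-- An anticommutative alternative algebra satisfies `(x * y) * (z * w) = 0`, stated modulo an
ideal containing all squares. -/
theorem mul_mul_mul_mem_of_sq_mem (h2 : (2 : F) ≠ 0)
    (hl : ∀ x y : U, (x * x) * y = x * (x * y))
    {A I : Submodule F U} (hI : IsIdealOf I I) (hA : IsIdealOf A I)
    (hsq : ∀ x ∈ I, x * x ∈ A) {x y z w : U} (hx : x ∈ I) (hy : y ∈ I) (hz : z ∈ I)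
    (hw : w ∈ I) : (x * y) * (z * w) ∈ A := by
  have hm : ∀ {a b}, a ∈ I → b ∈ I → a * b ∈ I := fun ha hb => (hI _ hb _ ha).1
  have ac : ∀ {a b}, a ∈ I → b ∈ I → A.mkQ (b * a) = -A.mkQ (a * b) := by
    intro a b ha hb
    have h := A.sub_mem (A.sub_mem (hsq _ (I.add_mem ha hb)) (hsq _ ha)) (hsq _ hb)
    rw [← A.ker_mkQ, LinearMap.mem_ker] at h
    simp only [add_mul, mul_add, map_add, map_sub] at h
    grind
  have right : ∀ {a b c}, a ∈ I → b ∈ I → c ∈ I →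
      A.mkQ (a * (c * b)) = -A.mkQ (a * (b * c)) := by
    intro a b c ha hb hc
    have h := ac hb hc
    rw [eq_neg_iff_add_eq_zero, ← map_add, ← LinearMap.mem_ker, A.ker_mkQ] at h
    have h' := (hA _ h a ha).1
    rwa [← A.ker_mkQ, LinearMap.mem_ker, mul_add, map_add, ← eq_neg_iff_add_eq_zero] at h'
  have left : ∀ {a b c}, a ∈ I → b ∈ I → c ∈ I →
      A.mkQ (b * (a * c)) = -A.mkQ (a * (b * c)) := by
    intro a b c ha hb hc
    have h := ac ha hb
    rw [eq_neg_iff_add_eq_zero, ← map_add, ← LinearMap.mem_ker, A.ker_mkQ] at h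
    have h' := (hA _ h c hc).2
    rw [← A.ker_mkQ, LinearMap.mem_ker] at h'
    rw [mul_mul_left_linearized hl b a c, ← add_mul, map_sub, h', zero_sub]
  have sq : ∀ {a b c}, a ∈ I → b ∈ I → c ∈ I → A.mkQ ((a * b) * (c * a)) = 0 := by
    intro a b c ha hb hc
    have h := left ha hc hb
    rw [eq_neg_iff_add_eq_zero, ← map_add, ← LinearMap.mem_ker, A.ker_mkQ] at h
    have h' := (hA _ h a ha).1
    rw [← A.ker_mkQ, LinearMap.mem_ker, mul_add, map_add, ← hl] at h'
    have h0 := (hA _ (hsq a ha) _ (hm hc hb)).2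
    rw [← A.ker_mkQ, LinearMap.mem_ker] at h0
    rw [left hc (hm ha hb) ha, right hc ha (hm ha hb), left ha hc (hm ha hb)]
    rw [h0, add_zero] at h'
    simp [h']
  have swap : ∀ {a b c d}, a ∈ I → b ∈ I → c ∈ I → d ∈ I →
      A.mkQ ((d * b) * (c * a)) = -A.mkQ ((a * b) * (c * d)) := by
    intro a b c d ha hb hc hd
    have h := sq (I.add_mem ha hd) hb hc
    simp only [add_mul, mul_add, map_add, sq ha hb hc, sq hd hb hc] at h
    grind
  have comm : ∀ {a b c d}, a ∈ I → b ∈ I → c ∈ I → d ∈ I →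
      A.mkQ ((b * a) * (c * d)) = -A.mkQ ((a * b) * (c * d)) := by
    intro a b c d ha hb hc hd
    have h := ac ha hb
    rw [eq_neg_iff_add_eq_zero, ← map_add, ← LinearMap.mem_ker, A.ker_mkQ] at h
    have h' := (hA _ h _ (hm hc hd)).2
    rwa [← A.ker_mkQ, LinearMap.mem_ker, add_mul, map_add, ← eq_neg_iff_add_eq_zero] at h'
  have comm' : ∀ {a b c d}, a ∈ I → b ∈ I → c ∈ I → d ∈ I →
      A.mkQ ((a * b) * (d * c)) = -A.mkQ ((a * b) * (c * d)) :=
    fun ha hb hc hd => right (hm ha hb) hc hd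
  have h : A.mkQ ((z * w) * (x * y)) = A.mkQ ((x * y) * (z * w)) := by
    rw [comm' hz hw hy hx, comm hw hz hy hx, swap hx hz hy hw, comm hz hx hy hw,
      comm' hz hx hw hy, comm hx hz hw hy, swap hy hz hw hx, comm hz hy hw hx,
      comm' hz hy hx hw, swap hw hy hx hz, comm' hw hy hz hx, swap hx hy hz hw]
    simp
  refine mem_of_add_self_mem h2 ?_
  rw [← A.ker_mkQ, LinearMap.mem_ker, map_add]
  nth_rewrite 1 [← h]
  rw [ac (hm hx hy) (hm hz hw)]
  simp

/-- Left multiplication by `u` and left multiplication by an ideal anticommute modulo an ideal of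
that ideal. -/
theorem mul_mul_add_mul_mul_mem (hl : ∀ x y : U, (x * x) * y = x * (x * y))
    {B I : Submodule F U} (hI : IsIdealOf I ⊤) (hB : IsIdealOf B I) (u : U) {a b : U}
    (ha : a ∈ I) (hb : b ∈ B) : a * (u * b) + u * (a * b) ∈ B := by
  have h := mul_mul_left_linearized hl a u b
  rw [← add_mul] at h
  rw [h, sub_add_cancel]
  exact (hB b hb _ (I.add_mem (hI a ha u trivial).2 (hI a ha u trivial).1)).1

/-- The span of the products of elements of an ideal `I` is an ideal. -/
theorem isIdealOf_span_mul [IsScalarTower F U U] [SMulCommClass F U U]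
    (hl : ∀ x y : U, (x * x) * y = x * (x * y)) (hr : ∀ x y : U, (y * x) * x = y * (x * x))
    {I : Submodule F U} (hI : IsIdealOf I ⊤) :
    IsIdealOf (Submodule.span F {z | ∃ x ∈ I, ∃ y ∈ I, x * y = z}) ⊤ := by
  intro z hz u _
  have mem : ∀ {a b}, a ∈ I → b ∈ I →
      a * b ∈ Submodule.span F {z | ∃ x ∈ I, ∃ y ∈ I, x * y = z} :=
    fun ha hb => Submodule.subset_span ⟨_, ha, _, hb, rfl⟩
  induction hz using Submodule.span_induction with
  | mem z hz =>
    obtain ⟨x, hx, y, hy, rfl⟩ := hz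
    constructor
    · rw [mul_mul_left_linearized hl]
      exact Submodule.sub_mem _ (Submodule.add_mem _ (mem (hI x hx u trivial).1 hy)
        (mem (hI x hx u trivial).2 hy)) (mem hx (hI y hy u trivial).1)
    · rw [mul_mul_right_linearized hr]
      exact Submodule.sub_mem _ (Submodule.add_mem _ (mem hx (hI y hy u trivial).2)
        (mem hx (hI y hy u trivial).1)) (mem (hI x hx u trivial).2 hy)
  | zero => simp
  | add x y _ _ h₁ h₂ =>
    rw [mul_add, add_mul]
    exact ⟨Submodule.add_mem _ h₁.1 h₂.1, Submodule.add_mem _ h₁.2 h₂.2⟩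
  | smul c x _ h =>
    rw [mul_smul_comm, smul_mul_assoc]
    exact ⟨Submodule.smul_mem _ c h.1, Submodule.smul_mem _ c h.2⟩

/-- If `I` is an idempotent ideal of `U` and `B` is an ideal of `I`, then `u * (I * B) ⊆ B`. -/
theorem mul_mul_mem_of_idempotent [IsScalarTower F U U] [SMulCommClass F U U] (h2 : (2 : F) ≠ 0)
    (hl : ∀ x y : U, (x * x) * y = x * (x * y)) (hr : ∀ x y : U, (y * x) * x = y * (x * x))
    {B I : Submodule F U} (hI : IsIdealOf I ⊤) (hB : IsIdealOf B I)
    (hidem : Submodule.span F {z | ∃ x ∈ I, ∃ y ∈ I, x * y = z} = I)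
    (u : U) {a b : U} (ha : a ∈ I) (hb : b ∈ B) : u * (a * b) ∈ B := by
  let A : Submodule F U :=
    { carrier := {a | a ∈ I ∧ ∀ b ∈ B, u * (a * b) ∈ B}
      zero_mem' := ⟨I.zero_mem, fun b _ => by simp⟩
      add_mem' := fun {x y} hx hy => ⟨I.add_mem hx.1 hy.1, fun b hb => by
        rw [add_mul, mul_add]
        exact B.add_mem (hx.2 b hb) (hy.2 b hb)⟩
      smul_mem' := fun c x hx => ⟨I.smul_mem c hx.1, fun b hb => by
        rw [smul_mul_assoc, mul_smul_comm]
        exact B.smul_mem c (hx.2 b hb)⟩ }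
  have hII : IsIdealOf I I := fun x hx y _ => hI x hx y trivial
  have anti : ∀ {a b}, a ∈ I → b ∈ B → a * (u * b) + u * (a * b) ∈ B :=
    fun ha hb => mul_mul_add_mul_mul_mem hl hI hB u ha hb
  have hsq : ∀ x ∈ I, x * x ∈ A := by
    refine fun x hx => ⟨(hII x hx x hx).1, fun b hb => mem_of_add_self_mem h2 ?_⟩
    have h₁ := anti (hII x hx x hx).1 hb
    have h₂ := (hB _ (anti hx hb) x hx).1
    have h₃ := anti hx (hB b hb x hx).1
    rw [hl, hl] at h₁
    rw [mul_add] at h₂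
    rw [hl]
    have h := B.add_mem (B.sub_mem h₁ h₂) h₃
    convert h using 1
    abel
  have mul_right : ∀ {x c}, x ∈ A → c ∈ I → x * c ∈ A := by
    intro x c hx hc
    refine ⟨(hII x hx.1 c hc).2, fun b hb => ?_⟩
    have hxb : x * b ∈ B := (hB b hb x hx.1).1
    have e : u * ((x * b) * c) ∈ B := by
      have h := mul_mul_right_linearized hr (x * b) c u
      have h₁ : u * (c * (x * b)) ∈ B := by
        have h := B.sub_mem (anti hc hxb) (hB _ (hx.2 b hb) c hc).1
        rwa [add_sub_cancel_left] at h
      have h₂ : (u * (x * b)) * c ∈ B := (hB _ (hx.2 b hb) c hc).2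
      have h₃ : (u * c) * (x * b) ∈ B := (hB _ hxb _ (hI c hc u trivial).1).1
      have h₄ : u * ((x * b) * c) = (u * (x * b)) * c + (u * c) * (x * b) - u * (c * (x * b)) := by
        rw [h]; abel
      rw [h₄]
      exact B.sub_mem (B.add_mem h₂ h₃) h₁
    rw [mul_mul_right_linearized hr c b x, mul_sub, mul_add]
    exact B.sub_mem (B.add_mem (hx.2 _ (hB b hb c hc).1) (hx.2 _ (hB b hb c hc).2)) e
  have hA : IsIdealOf A I := by
    intro x hx c hc
    refine ⟨?_, mul_right hx hc⟩
    have h := A.sub_mem (A.sub_mem (A.sub_mem (hsq _ (I.add_mem hx.1 hc)) (hsq x hx.1))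
      (hsq c hc)) (mul_right hx hc)
    simp only [add_mul, mul_add] at h
    convert h using 1
    abel
  have prod : ∀ {p q}, p ∈ I → q ∈ I → p * q ∈ A := by
    intro p q hp hq
    rw [← hidem] at hp hq
    induction hp, hq using Submodule.span_induction₂ with
    | mem_mem p q hp hq =>
      obtain ⟨x, hx, y, hy, rfl⟩ := hp
      obtain ⟨z, hz, w, hw, rfl⟩ := hq
      exact mul_mul_mul_mem_of_sq_mem h2 hl hII hA hsq hx hy hz hw
    | zero_left => simp
    | zero_right => simp
    | add_left _ _ _ _ _ _ h₁ h₂ => rw [add_mul]; exact A.add_mem h₁ h₂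
    | add_right _ _ _ _ _ _ h₁ h₂ => rw [mul_add]; exact A.add_mem h₁ h₂
    | smul_left c _ _ _ _ h => rw [smul_mul_assoc]; exact A.smul_mem c h
    | smul_right c _ _ _ _ h => rw [mul_smul_comm]; exact A.smul_mem c h
  have hIA : I ≤ A := by
    conv_lhs => rw [← hidem]
    rw [Submodule.span_le]
    rintro _ ⟨x, hx, y, hy, rfl⟩
    exact prod hx hy
  exact (hIA ha).2 b hb

/-- The elements of `B` that multiplication by any element of `U` keeps in `B`. -/
def stablePart [IsScalarTower F U U] [SMulCommClass F U U] (B : Submodule F U) :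
    Submodule F U where
  carrier := {b | b ∈ B ∧ ∀ u : U, u * b ∈ B ∧ b * u ∈ B}
  zero_mem' := ⟨B.zero_mem, fun u => by simp⟩
  add_mem' := fun {x y} hx hy => ⟨B.add_mem hx.1 hy.1, fun u => by
    rw [mul_add, add_mul]
    exact ⟨B.add_mem (hx.2 u).1 (hy.2 u).1, B.add_mem (hx.2 u).2 (hy.2 u).2⟩⟩
  smul_mem' := fun c x hx => ⟨B.smul_mem c hx.1, fun u => by
    rw [mul_smul_comm, smul_mul_assoc]
    exact ⟨B.smul_mem c (hx.2 u).1, B.smul_mem c (hx.2 u).2⟩⟩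

theorem stablePart_le [IsScalarTower F U U] [SMulCommClass F U U] (B : Submodule F U) :
    stablePart B ≤ B :=
  fun _ hx => hx.1

theorem isIdealOf_stablePart [IsScalarTower F U U] [SMulCommClass F U U]
    (hl : ∀ x y : U, (x * x) * y = x * (x * y)) (hr : ∀ x y : U, (y * x) * x = y * (x * x))
    {B I : Submodule F U} (hI : IsIdealOf I ⊤) (hB : IsIdealOf B I) :
    IsIdealOf (stablePart B) I := by
  rintro p ⟨hpB, hp⟩ i hi
  have iu : ∀ u, i * u ∈ I := fun u => (hI i hi u trivial).2
  have ui : ∀ u, u * i ∈ I := fun u => (hI i hi u trivial).1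
  have left : ∀ u, u * (p * i) ∈ B := fun u => by
    rw [mul_mul_left_linearized hl]
    exact B.sub_mem (B.add_mem (hB _ (hp u).1 i hi).2 (hB _ (hp u).2 i hi).2)
      (hB p hpB _ (ui u)).2
  have right : ∀ u, (i * p) * u ∈ B := fun u => by
    rw [mul_mul_right_linearized hr]
    exact B.sub_mem (B.add_mem (hB _ (hp u).2 i hi).1 (hB _ (hp u).1 i hi).1)
      (hB p hpB _ (iu u)).1
  refine ⟨⟨(hB p hpB i hi).1, fun u => ⟨?_, right u⟩⟩, ⟨(hB p hpB i hi).2, fun u => ⟨left u, ?_⟩⟩⟩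
  · have h := mul_mul_right_linearized hr i p u
    have e : u * (i * p) = (u * i) * p + (u * p) * i - u * (p * i) := by rw [h]; abel
    rw [e]
    exact B.sub_mem (B.add_mem (hB p hpB _ (ui u)).1 (hB _ (hp u).1 i hi).2) (left u)
  · have h := mul_mul_left_linearized hl p i u
    have e : (p * i) * u = p * (i * u) + i * (p * u) - (i * p) * u := by rw [h]; abel
    rw [e]
    exact B.sub_mem (B.add_mem (hB p hpB _ (iu u)).2 (hB _ (hp u).2 i hi).1) (right u)

/-- The triple product `(I * B) * I` lies in the stable part of `B` when `I` is idempotent. -/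
theorem mul_mul_mem_stablePart [IsScalarTower F U U] [SMulCommClass F U U] (h2 : (2 : F) ≠ 0)
    (hl : ∀ x y : U, (x * x) * y = x * (x * y)) (hr : ∀ x y : U, (y * x) * x = y * (x * x))
    {B I : Submodule F U} (hI : IsIdealOf I ⊤) (hB : IsIdealOf B I)
    (hidem : Submodule.span F {z | ∃ x ∈ I, ∃ y ∈ I, x * y = z} = I)
    {i b j : U} (hi : i ∈ I) (hb : b ∈ B) (hj : j ∈ I) : (i * b) * j ∈ stablePart B := by
  have key : ∀ u {a b}, a ∈ I → b ∈ B → u * (a * b) ∈ B :=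
    fun u _ _ ha hb => mul_mul_mem_of_idempotent h2 hl hr hI hB hidem u ha hb
  have hib : i * b ∈ B := (hB b hb i hi).1
  have left : ∀ u, u * ((i * b) * j) ∈ B := fun u => by
    rw [mul_mul_right_linearized hr, mul_sub, mul_add]
    exact B.sub_mem (B.add_mem (key u hi (hB b hb j hj).2) (key u hi (hB b hb j hj).1))
      (key u (hI i hi j trivial).2 hb)
  refine ⟨(hB _ hib j hj).2, fun u => ⟨left u, ?_⟩⟩
  have h₁ := mul_mul_right_linearized hr j u (i * b)
  have h₂ := mul_mul_left_linearized hl (i * b) u j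
  have e : ((i * b) * j) * u = (i * b) * (j * u) + (u * (i * b)) * j - u * ((i * b) * j) := by
    rw [h₁, h₂]; abel
  rw [e]
  exact B.sub_mem (B.add_mem (hB _ hib _ (hI j hj u trivial).2).2 (hB _ (key u hi hb) j hj).2)
    (left u)

/-- The elements of an ideal `I` that annihilate `I` from the left form an ideal. -/
theorem exists_isIdealOf_left_annihilator [IsScalarTower F U U]
    (hl : ∀ x y : U, (x * x) * y = x * (x * y)) (hr : ∀ x y : U, (y * x) * x = y * (x * x))
    {I : Submodule F U} (hI : IsIdealOf I ⊤) :
    ∃ K : Submodule F U, IsIdealOf K ⊤ ∧ ∀ x, x ∈ K ↔ x ∈ I ∧ ∀ y ∈ I, x * y = 0 := by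
  refine ⟨{ carrier := {x | x ∈ I ∧ ∀ y ∈ I, x * y = 0}
            zero_mem' := ⟨I.zero_mem, fun y _ => zero_mul y⟩
            add_mem' := fun {a b} ha hb => ⟨I.add_mem ha.1 hb.1, fun y hy => by
              rw [add_mul, ha.2 y hy, hb.2 y hy, add_zero]⟩
            smul_mem' := fun c a ha => ⟨I.smul_mem c ha.1, fun y hy => by
              rw [smul_mul_assoc, ha.2 y hy, smul_zero]⟩ }, ?_, fun x => Iff.rfl⟩
  rintro x ⟨hx, h⟩ u -
  have right : ∀ y ∈ I, (x * u) * y = 0 := fun y hy => by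
    rw [mul_mul_right_linearized hr, h y hy, h _ (hI y hy u trivial).1, h _ (hI y hy u trivial).2]
    simp
  refine ⟨⟨(hI x hx u trivial).1, fun y hy => ?_⟩, (hI x hx u trivial).2, right⟩
  have e := mul_mul_left_linearized hl u x y
  rw [h y hy, right y hy, h _ (hI y hy u trivial).1] at e
  simpa using e.symm

/-- The elements of an ideal `I` that annihilate `I` from the right form an ideal. -/
theorem exists_isIdealOf_right_annihilator [SMulCommClass F U U]
    (hl : ∀ x y : U, (x * x) * y = x * (x * y)) (hr : ∀ x y : U, (y * x) * x = y * (x * x))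
    {I : Submodule F U} (hI : IsIdealOf I ⊤) :
    ∃ K : Submodule F U, IsIdealOf K ⊤ ∧ ∀ x, x ∈ K ↔ x ∈ I ∧ ∀ y ∈ I, y * x = 0 := by
  refine ⟨{ carrier := {x | x ∈ I ∧ ∀ y ∈ I, y * x = 0}
            zero_mem' := ⟨I.zero_mem, fun y _ => mul_zero y⟩
            add_mem' := fun {a b} ha hb => ⟨I.add_mem ha.1 hb.1, fun y hy => by
              rw [mul_add, ha.2 y hy, hb.2 y hy, add_zero]⟩
            smul_mem' := fun c a ha => ⟨I.smul_mem c ha.1, fun y hy => by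
              rw [mul_smul_comm, ha.2 y hy, smul_zero]⟩ }, ?_, fun x => Iff.rfl⟩
  rintro x ⟨hx, h⟩ u -
  have left : ∀ y ∈ I, y * (u * x) = 0 := fun y hy => by
    rw [mul_mul_left_linearized hl, h y hy, h _ (hI y hy u trivial).1, h _ (hI y hy u trivial).2]
    simp
  refine ⟨⟨(hI x hx u trivial).1, left⟩, (hI x hx u trivial).2, fun y hy => ?_⟩
  have e := mul_mul_right_linearized hr x u y
  rw [h y hy, left y hy, h _ (hI y hy u trivial).2] at e
  simpa using e.symm

/-- An ideal of a minimal ideal `I` with nonzero multiplication is zero or `I`. -/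
theorem eq_bot_or_eq_of_isIdealOf [IsScalarTower F U U] [SMulCommClass F U U]
    [FiniteDimensional F U] (h2 : (2 : F) ≠ 0)
    (hl : ∀ x y : U, (x * x) * y = x * (x * y)) (hr : ∀ x y : U, (y * x) * x = y * (x * x))
    {I : Submodule F U} (hI : IsIdealOf I ⊤)
    (hmin : ∀ K : Submodule F U, IsIdealOf K ⊤ → K ≤ I → K = ⊥ ∨ K = I)
    (hne : ∃ x ∈ I, ∃ y ∈ I, x * y ≠ 0) (B : Submodule F U) (hBI : B ≤ I)
    (hB : IsIdealOf B I) : B = ⊥ ∨ B = I := by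
  obtain ⟨x, hx, y, hy, hxy⟩ := hne
  have hidem : Submodule.span F {z | ∃ x ∈ I, ∃ y ∈ I, x * y = z} = I := by
    refine (hmin _ (isIdealOf_span_mul hl hr hI) ?_).resolve_left fun h => hxy ?_
    · rw [Submodule.span_le]
      rintro _ ⟨a, ha, b, -, rfl⟩
      exact (hI a ha b trivial).2
    · exact (Submodule.mem_bot F).1 (h ▸ Submodule.subset_span ⟨x, hx, y, hy, rfl⟩)
  have left_ann : ∀ a ∈ I, (∀ b ∈ I, a * b = 0) → a = 0 := by
    obtain ⟨K, hK, hmem⟩ := exists_isIdealOf_left_annihilator hl hr hI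
    rcases hmin K hK fun a ha => ((hmem a).1 ha).1 with h | h
    · intro a ha hab
      exact (Submodule.mem_bot F).1 (h ▸ (hmem a).2 ⟨ha, hab⟩)
    · exact absurd (((hmem x).1 (h ▸ hx)).2 y hy) hxy
  have right_ann : ∀ a ∈ I, (∀ b ∈ I, b * a = 0) → a = 0 := by
    obtain ⟨K, hK, hmem⟩ := exists_isIdealOf_right_annihilator hl hr hI
    rcases hmin K hK fun a ha => ((hmem a).1 ha).1 with h | h
    · intro a ha hab
      exact (Submodule.mem_bot F).1 (h ▸ (hmem a).2 ⟨ha, hab⟩)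
    · exact absurd (((hmem y).1 (h ▸ hy)).2 x hx) hxy
  induction B using WellFoundedLT.induction with
  | ind B ih =>
    rcases (stablePart_le B).eq_or_lt with h | h
    · refine hmin B (fun b hb u _ => ?_) hBI
      rw [← h] at hb
      exact hb.2 u
    · rcases ih _ h (h.le.trans hBI) (isIdealOf_stablePart hl hr hI hB) with h₀ | h₀
      · refine Or.inl ((Submodule.eq_bot_iff B).2 fun b hb => ?_)
        refine right_ann b (hBI hb) fun i hi => ?_
        refine left_ann _ (hI i hi b trivial).2 fun j hj => ?_
        exact (Submodule.mem_bot F).1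
          (h₀ ▸ mul_mul_mem_stablePart h2 hl hr hI hB hidem hi hb hj)
      · exact absurd (h₀ ▸ h) hBI.not_gt

end Alternative

end AlternativeAlgebra

/-- Let `U` be a finite-dimensional alternative algebra over a field `F` of
characteristic different from 2, 3 and 5, and let `I` be a minimal two-sided
ideal of `U`.  Then either `I·I = 0` or `I` is a simple algebra. -/
theorem minimal_ideal_square_zero_or_simple
    (F : Type*) [Field F]
    (hchar : ringChar F ≠ 2 ∧ ringChar F ≠ 3 ∧ ringChar F ≠ 5)
    (U : Type*) [NonUnitalNonAssocRing U] [Module F U]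
    [SMulCommClass F U U] [IsScalarTower F U U] [FiniteDimensional F U]
    (halt : ∀ x y : U, (x * x) * y = x * (x * y) ∧ (y * x) * x = y * (x * x))
    (I : Submodule F U) (hI0 : I ≠ ⊥)
    (hIideal : ∀ x ∈ I, ∀ y : U, y * x ∈ I ∧ x * y ∈ I)
    (hImin : ∀ K : Submodule F U, (∀ x ∈ K, ∀ y : U, y * x ∈ K ∧ x * y ∈ K) →
      K ≤ I → K = ⊥ ∨ K = I) :
    (∀ x ∈ I, ∀ y ∈ I, x * y = 0) ∨
    ((∃ x ∈ I, ∃ y ∈ I, x * y ≠ 0) ∧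
      ∀ K : Submodule F U, K ≤ I →
        (∀ x ∈ K, ∀ y ∈ I, y * x ∈ K ∧ x * y ∈ K) → K = ⊥ ∨ K = I) := by
  have h2 : (2 : F) ≠ 0 := Ring.two_ne_zero hchar.1
  by_cases h : ∃ x ∈ I, ∃ y ∈ I, x * y ≠ 0
  · refine Or.inr ⟨h, fun K hKI hK => ?_⟩
    exact AlternativeAlgebra.eq_bot_or_eq_of_isIdealOf h2 (fun x y => (halt x y).1)
      (fun x y => (halt x y).2) (fun x hx y _ => hIideal x hx y)
      (fun K hK => hImin K fun x hx y => hK x hx y trivial) h K hKI hK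
  · push Not at h
    exact Or.inl h
end

section
/- Let U be an alternative ring and e_1, e_2 orthogonal idempotents (e_i² = e_i, e_1·e_2 = e_2·e_1 = 0), with Peirce spaces U_{ij} = {x ∈ U : e_k·x = δ_{ki}·x and x·e_k = δ_{jk}·x for k = 1, 2}. Suppose h_{12} ∈ U_{12}, h_{21} ∈ U_{21}, a_1 ∈ U_{11} and a_2 ∈ U_{22} satisfy h_{12}·h_{21} = e_1 + a_1, h_{21}·h_{12} = e_2 + a_2, and a_1² = a_2² = 0. Put p_{12} = (e_1 − a_1)·h_{12} and p_{21} = h_{21}. Then p_{12} ∈ U_{12}, p_{21} ∈ U_{21}, p_{12}·p_{21} = e_1 and p_{21}·p_{12} = e_2. -/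
/-! Correcting almost-inverse Peirce elements to exact ones in an alternative
ring. -/

theorem associator_swap_left_of_alternative {U : Type*} [NonUnitalNonAssocRing U]
    (halt : ∀ x y : U, (x * x) * y = x * (x * y) ∧ (y * x) * x = y * (x * x))
    (x y z : U) :
    associator x y z = -associator y x z := by
  have h := (halt (x + y) z).1
  simp only [add_mul, mul_add, (halt x z).1, (halt y z).1] at h
  simp only [associator]
  rw [← sub_eq_zero] at h ⊢
  rw [← h]
  abel

theorem associator_swap_right_of_alternative {U : Type*} [NonUnitalNonAssocRing U]
    (halt : ∀ x y : U, (x * x) * y = x * (x * y) ∧ (y * x) * x = y * (x * x))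
    (x y z : U) :
    associator x y z = -associator x z y := by
  have h := (halt (y + z) x).2
  simp only [add_mul, mul_add, (halt y x).2, (halt z x).2] at h
  simp only [associator]
  rw [← sub_eq_zero] at h ⊢
  rw [← h]
  abel

theorem associator_mul_self_of_alternative {U : Type*} [NonUnitalNonAssocRing U]
    (halt : ∀ x y : U, (x * x) * y = x * (x * y) ∧ (y * x) * x = y * (x * x))
    (x y : U) : associator (x * y) x y = 0 := by
  have h : associator x (x * y) y = 0 := by
    have h₁ := (halt x y).1
    have h₂ := (halt y x).2
    have h₃ := (halt y (x * x)).2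
    have h₄ := (halt x (y * y)).1
    simp only [associator]
    rw [← h₁, h₃, h₂, h₄, sub_self]
  rw [associator_swap_left_of_alternative halt, h, neg_zero]

theorem mul_mul_self_flexible_of_alternative {U : Type*} [NonUnitalNonAssocRing U]
    (halt : ∀ x y : U, (x * x) * y = x * (x * y) ∧ (y * x) * x = y * (x * x))
    (x y : U) : (x * y) * x = x * (y * x) := by
  have h := associator_swap_left_of_alternative halt x y x
  rwa [associator, associator, (halt x y).2, sub_self, neg_zero, sub_eq_zero] at h

/-- If `x * y` differs by `a` from an element `e` that acts as a left unit on `x` and on `x * y`,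
then `a`, `x`, `y` associate. -/
theorem associator_eq_zero_of_mul_eq_add {U : Type*} [NonUnitalNonAssocRing U]
    (halt : ∀ x y : U, (x * x) * y = x * (x * y) ∧ (y * x) * x = y * (x * x))
    {x y e a : U} (hxy : x * y = e + a)
    (he : e * e = e) (hea : e * a = a) (hex : e * x = x) : associator a x y = 0 := by
  have h := associator_mul_self_of_alternative halt x y
  have h_unit : associator e x y = 0 := by
    simp [associator, hex, hxy, mul_add, he, hea]
  have h_add : associator (e + a) x y = associator e x y + associator a x y := by
    simp only [associator, add_mul]
    abel
  rwa [hxy, h_add, h_unit, zero_add] at h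

/-- Let `U` be an alternative ring with orthogonal idempotents `e₁, e₂` and
Peirce spaces `U_{ij}`.  If `h₁₂ ∈ U₁₂`, `h₂₁ ∈ U₂₁`, `a₁ ∈ U₁₁`, `a₂ ∈ U₂₂`
satisfy `h₁₂·h₂₁ = e₁ + a₁`, `h₂₁·h₁₂ = e₂ + a₂` and `a₁² = a₂² = 0`, then
`p₁₂ = (e₁ − a₁)·h₁₂ ∈ U₁₂`, `p₂₁ = h₂₁ ∈ U₂₁`, `p₁₂·p₂₁ = e₁` and
`p₂₁·p₁₂ = e₂`. -/
theorem peirce_inverse_correction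
    (U : Type*) [NonUnitalNonAssocRing U]
    (halt : ∀ x y : U, (x * x) * y = x * (x * y) ∧ (y * x) * x = y * (x * x))
    (e1 e2 : U) (he1 : e1 * e1 = e1) (he2 : e2 * e2 = e2)
    (horth : e1 * e2 = 0 ∧ e2 * e1 = 0)
    (h12 h21 a1 a2 : U)
    -- h12 ∈ U₁₂
    (hh12 : e1 * h12 = h12 ∧ e2 * h12 = 0 ∧ h12 * e2 = h12 ∧ h12 * e1 = 0)
    -- h21 ∈ U₂₁
    (hh21 : e2 * h21 = h21 ∧ e1 * h21 = 0 ∧ h21 * e1 = h21 ∧ h21 * e2 = 0)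
    -- a1 ∈ U₁₁
    (ha1 : e1 * a1 = a1 ∧ e2 * a1 = 0 ∧ a1 * e1 = a1 ∧ a1 * e2 = 0)
    -- a2 ∈ U₂₂
    (ha2 : e2 * a2 = a2 ∧ e1 * a2 = 0 ∧ a2 * e2 = a2 ∧ a2 * e1 = 0)
    (hm1 : h12 * h21 = e1 + a1) (hm2 : h21 * h12 = e2 + a2)
    (hsq1 : a1 * a1 = 0) (hsq2 : a2 * a2 = 0) :
    -- p₁₂ = (e₁ − a₁)·h₁₂ ∈ U₁₂
    (e1 * ((e1 - a1) * h12) = (e1 - a1) * h12 ∧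
      e2 * ((e1 - a1) * h12) = 0 ∧
      ((e1 - a1) * h12) * e2 = (e1 - a1) * h12 ∧
      ((e1 - a1) * h12) * e1 = 0) ∧
    -- p₂₁ = h₂₁ ∈ U₂₁
    (e2 * h21 = h21 ∧ e1 * h21 = 0 ∧ h21 * e1 = h21 ∧ h21 * e2 = 0) ∧
    ((e1 - a1) * h12) * h21 = e1 ∧
    h21 * ((e1 - a1) * h12) = e2 := by
  obtain ⟨hx1, hx2, hx3, hx4⟩ := hh12
  obtain ⟨hy1, hy2, hy3, hy4⟩ := hh21
  obtain ⟨ha11, ha12, ha13, ha14⟩ := ha1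
  have swapL := associator_swap_left_of_alternative halt
  have swapR := associator_swap_right_of_alternative halt
  have h_e1 : associator a1 e1 h12 = 0 := by simp [associator, ha13, hx1]
  have h_e2 : associator a1 e2 h12 = 0 := by simp [associator, ha14, hx2]
  have h_left1 : e1 * (a1 * h12) = a1 * h12 := by
    have h := swapL e1 a1 h12
    rw [h_e1, associator, ha11, neg_zero, sub_eq_zero] at h
    exact h.symm
  have h_left2 : e2 * (a1 * h12) = 0 := by
    have h := swapL e2 a1 h12
    rwa [h_e2, associator, ha12, zero_mul, zero_sub, neg_inj] at h
  have h_right1 : (a1 * h12) * e1 = 0 := by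
    have h := swapR a1 h12 e1
    rwa [h_e1, associator, hx4, mul_zero, sub_zero, neg_zero] at h
  have h_right2 : (a1 * h12) * e2 = a1 * h12 := by
    have h := swapR a1 h12 e2
    rwa [h_e2, associator, hx3, neg_zero, sub_eq_zero] at h
  have h_assoc1 := associator_eq_zero_of_mul_eq_add halt hm1 he1 ha11 hx1
  have h_assoc2 := associator_eq_zero_of_mul_eq_add halt hm2 he2 ha2.1 hy1
  have h_mul1 : (a1 * h12) * h21 = a1 := by
    rwa [associator, hm1, mul_add, ha13, hsq1, add_zero, sub_eq_zero] at h_assoc1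
  have h_mul2 : (a2 * h21) * h12 = a2 := by
    rwa [associator, hm2, mul_add, ha2.2.2.1, hsq2, add_zero, sub_eq_zero] at h_assoc2
  have h_comm : h21 * a1 = a2 * h21 := by
    have h := mul_mul_self_flexible_of_alternative halt h21 h12
    rw [hm1, hm2, add_mul, mul_add, hy1, hy3] at h
    exact (add_left_cancel h).symm
  have h_mul3 : h21 * (a1 * h12) = a2 := by
    have h : associator h21 a1 h12 = 0 := by
      rw [swapL, swapR, h_assoc1, neg_zero, neg_zero]
    rw [associator, h_comm, h_mul2, sub_eq_zero] at h
    exact h.symm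
  rw [sub_mul, hx1]
  refine ⟨⟨?_, ?_, ?_, ?_⟩, ⟨hy1, hy2, hy3, hy4⟩, ?_, ?_⟩
  · rw [mul_sub, hx1, h_left1]
  · rw [mul_sub, hx2, h_left2, sub_zero]
  · rw [sub_mul, hx3, h_right2]
  · rw [sub_mul, hx4, h_right1, sub_zero]
  · rw [sub_mul, hm1, h_mul1, add_sub_cancel_right]
  · rw [mul_sub, hm2, h_mul3, add_sub_cancel_right]
end
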